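/- arXiv:2302.13044 — 5 statements merged into one kernel-verified Lean document; each statement's English description precedes it below -/
import Mathlib

section
/- Let P be an admissible two-point kernel for β and J. Suppose there exist a finite set S ⊂ ℤ^d containing 0 and a vector t ∈ ℝ^d such that φ_β(S,t) < 1. Then, with C := ∑_{v∈S} e^{⟨t,v⟩}, for every finite Λ ⊂ ℤ^d and every u ∈ Λ one has ∑_{v∈Λ} e^{⟨t, v−u⟩} P_Λ(u,v) ≤ C/(1 − φ_β(S,t)). -/
open scoped BigOperators ENNReal

noncomputable section

/-- The lattice `ℤ^d`. -/
abbrev Zd (d : ℕ) := Fin d → ℤ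

/-- Standard inner product `⟨t, x⟩` between `t ∈ ℝ^d` and a lattice point `x ∈ ℤ^d`. -/
def dotp {d : ℕ} (t : Fin d → ℝ) (x : Zd d) : ℝ := ∑ i, t i * (x i : ℝ)

/-- An admissible two-point kernel for `β` and `J`: a family `P_Λ : ℤ^d × ℤ^d → [0,1]`
indexed by finite `Λ ⊂ ℤ^d`, vanishing unless both arguments lie in `Λ`,
translation invariant, and satisfying the Simon–Lieb inequality.
(Since `P_Λ(y,v) = 0` for `y ∉ Λ`, the sum over `y ∉ u+S` in the Simon–Lieb
inequality is written as a finite sum over `y ∈ Λ \ (u+S)`.) -/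
structure AdmissibleKernel (d : ℕ) (β : ℝ) (J : Zd d → ℝ) where
  P : Finset (Zd d) → Zd d → Zd d → ℝ
  nonneg : ∀ Λ u v, 0 ≤ P Λ u v
  le_one : ∀ Λ u v, P Λ u v ≤ 1
  vanish_left : ∀ Λ u v, u ∉ Λ → P Λ u v = 0
  vanish_right : ∀ Λ u v, v ∉ Λ → P Λ u v = 0
  translation : ∀ (w : Zd d) (Λ : Finset (Zd d)) (u v : Zd d),
      P (Λ.image (w + ·)) (w + u) (w + v) = P Λ u v
  simon_lieb : ∀ (S : Finset (Zd d)), (0 : Zd d) ∈ S →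
      ∀ (Λ : Finset (Zd d)), ∀ u ∈ Λ, ∀ v ∈ Λ, v ∉ S.image (u + ·) →
        P Λ u v ≤ β * ∑ x ∈ S.image (u + ·), ∑ y ∈ Λ \ S.image (u + ·),
          P (S.image (u + ·)) u x * J (y - x) * P Λ y v

/-- `φ_β(S,t) = β ∑_{x∈S} ∑_{y∉S} e^{⟨t,x⟩} P_S(0,x) J(y−x) e^{⟨t,y−x⟩}`,
valued in `[0,∞]` (the sum over `y ∉ S` is an infinite sum of nonnegative terms). -/
def phiE {d : ℕ} {β : ℝ} {J : Zd d → ℝ} (K : AdmissibleKernel d β J)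
    (S : Finset (Zd d)) (t : Fin d → ℝ) : ℝ≥0∞ :=
  ENNReal.ofReal β * ∑ x ∈ S, ∑' y : {y : Zd d // y ∉ S},
    ENNReal.ofReal (Real.exp (dotp t x) * K.P S 0 x * J ((y : Zd d) - x)
      * Real.exp (dotp t ((y : Zd d) - x)))

theorem dotp_add {d : ℕ} (t : Fin d → ℝ) (x y : Zd d) :
    dotp t (x + y) = dotp t x + dotp t y := by
  simp [dotp, mul_add, Finset.sum_add_distrib]

/-- A translated finite portion of the sum defining `phiE` is bounded by `phiE`. -/
theorem sum_translate_le_phiE_toReal {d : ℕ} {β : ℝ} (hβ : 0 ≤ β) {J : Zd d → ℝ}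
    (hJnn : ∀ x, 0 ≤ J x) (K : AdmissibleKernel d β J) (S : Finset (Zd d))
    (t : Fin d → ℝ) (hφ : phiE K S t ≠ ⊤) (Λ : Finset (Zd d)) (u : Zd d) :
    β * ∑ x ∈ S.image (u + ·), ∑ y ∈ Λ \ S.image (u + ·),
      Real.exp (dotp t (x - u)) * K.P (S.image (u + ·)) u x * J (y - x)
        * Real.exp (dotp t (y - x)) ≤ (phiE K S t).toReal := by
  have hnn : ∀ x y, 0 ≤ Real.exp (dotp t x) * K.P S 0 x * J (y - x)
      * Real.exp (dotp t (y - x)) := fun x y =>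
    mul_nonneg (mul_nonneg (mul_nonneg (Real.exp_nonneg _) (K.nonneg _ _ _)) (hJnn _))
      (Real.exp_nonneg _)
  have key : β * ∑ x ∈ S.image (u + ·), ∑ y ∈ Λ \ S.image (u + ·),
      Real.exp (dotp t (x - u)) * K.P (S.image (u + ·)) u x * J (y - x)
        * Real.exp (dotp t (y - x))
      = β * ∑ x ∈ S, ∑ z ∈ (Λ \ S.image (u + ·)).image (· - u),
        Real.exp (dotp t x) * K.P S 0 x * J (z - x) * Real.exp (dotp t (z - x)) := by
    rw [Finset.sum_image (fun a _ b _ h => add_left_cancel h)]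
    congr 1
    refine Finset.sum_congr rfl fun x _ => ?_
    rw [Finset.sum_image (fun a _ b _ h => sub_left_injective h)]
    refine Finset.sum_congr rfl fun y _ => ?_
    have h := K.translation u S 0 x
    rw [add_zero] at h
    rw [h, add_sub_cancel_left, sub_sub]
  rw [key, ← ENNReal.ofReal_le_iff_le_toReal hφ, ENNReal.ofReal_mul hβ,
    ENNReal.ofReal_sum_of_nonneg (fun x _ => Finset.sum_nonneg fun y _ => hnn x y), phiE]
  gcongr with x hx
  rw [ENNReal.ofReal_sum_of_nonneg (fun y _ => hnn x y)]
  have hmem : ∀ z ∈ (Λ \ S.image (u + ·)).image (· - u), z ∉ S := by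
    intro z hz hzS
    obtain ⟨y, hy, rfl⟩ := Finset.mem_image.1 hz
    exact (Finset.mem_sdiff.1 hy).2 (Finset.mem_image.2 ⟨y - u, hzS, add_sub_cancel u y⟩)
  rw [← Finset.sum_subtype_of_mem _ hmem]
  exact ENNReal.sum_le_tsum _

/-- One step of the Simon–Lieb iteration for the tilted susceptibility. -/
theorem sum_exp_mul_le_add {d : ℕ} {β : ℝ} (hβ : 0 ≤ β) {J : Zd d → ℝ}
    (hJnn : ∀ x, 0 ≤ J x) (K : AdmissibleKernel d β J) {S : Finset (Zd d)}
    (hS : (0 : Zd d) ∈ S) (t : Fin d → ℝ) (hφ : phiE K S t ≠ ⊤) (Λ : Finset (Zd d))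
    {M : ℝ} (hM0 : 0 ≤ M)
    (hM : ∀ y ∈ Λ, ∑ v ∈ Λ, Real.exp (dotp t (v - y)) * K.P Λ y v ≤ M)
    {u : Zd d} (hu : u ∈ Λ) :
    ∑ v ∈ Λ, Real.exp (dotp t (v - u)) * K.P Λ u v
      ≤ ∑ v ∈ S, Real.exp (dotp t v) + (phiE K S t).toReal * M := by
  rw [← Finset.sum_inter_add_sum_sdiff Λ (S.image (u + ·))]
  refine add_le_add ?_ ?_
  · calc ∑ v ∈ Λ ∩ S.image (u + ·), Real.exp (dotp t (v - u)) * K.P Λ u v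
        ≤ ∑ v ∈ Λ ∩ S.image (u + ·), Real.exp (dotp t (v - u)) :=
          Finset.sum_le_sum fun v _ =>
            mul_le_of_le_one_right (Real.exp_nonneg _) (K.le_one _ _ _)
      _ ≤ ∑ v ∈ S.image (u + ·), Real.exp (dotp t (v - u)) :=
          Finset.sum_le_sum_of_subset_of_nonneg Finset.inter_subset_right
            fun _ _ _ => Real.exp_nonneg _
      _ = ∑ v ∈ S, Real.exp (dotp t v) := by
          rw [Finset.sum_image (fun a _ b _ h => add_left_cancel h)]
          simp
  · set T := S.image (u + ·) with hT
    calc ∑ v ∈ Λ \ T, Real.exp (dotp t (v - u)) * K.P Λ u v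
        ≤ ∑ v ∈ Λ \ T, Real.exp (dotp t (v - u)) *
            (β * ∑ x ∈ T, ∑ y ∈ Λ \ T, K.P T u x * J (y - x) * K.P Λ y v) := by
          refine Finset.sum_le_sum fun v hv => ?_
          rw [Finset.mem_sdiff] at hv
          exact mul_le_mul_of_nonneg_left (K.simon_lieb S hS Λ u hu v hv.1 hv.2)
            (Real.exp_nonneg _)
      _ = β * ∑ x ∈ T, ∑ y ∈ Λ \ T, (Real.exp (dotp t (x - u)) * K.P T u x * J (y - x)
            * Real.exp (dotp t (y - x))) *
            ∑ v ∈ Λ \ T, Real.exp (dotp t (v - y)) * K.P Λ y v := by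
          simp only [Finset.mul_sum]
          rw [Finset.sum_comm]
          refine Finset.sum_congr rfl fun x _ => ?_
          rw [Finset.sum_comm]
          refine Finset.sum_congr rfl fun y _ => Finset.sum_congr rfl fun v _ => ?_
          have h : v - u = (x - u) + (y - x) + (v - y) := by abel
          rw [h, dotp_add, dotp_add, Real.exp_add, Real.exp_add]
          ring
      _ ≤ β * ∑ x ∈ T, ∑ y ∈ Λ \ T, (Real.exp (dotp t (x - u)) * K.P T u x * J (y - x)
            * Real.exp (dotp t (y - x))) * M := by
          refine mul_le_mul_of_nonneg_left (Finset.sum_le_sum fun x _ =>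
            Finset.sum_le_sum fun y hy => mul_le_mul_of_nonneg_left ?_ ?_) hβ
          · refine le_trans (Finset.sum_le_sum_of_subset_of_nonneg Finset.sdiff_subset
              fun v _ _ => mul_nonneg (Real.exp_nonneg _) (K.nonneg _ _ _)) (hM y ?_)
            exact (Finset.mem_sdiff.1 hy).1
          · exact mul_nonneg (mul_nonneg (mul_nonneg (Real.exp_nonneg _) (K.nonneg _ _ _))
              (hJnn _)) (Real.exp_nonneg _)
      _ = (β * ∑ x ∈ T, ∑ y ∈ Λ \ T, Real.exp (dotp t (x - u)) * K.P T u x * J (y - x)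
            * Real.exp (dotp t (y - x))) * M := by
          simp only [← Finset.sum_mul]
          rw [mul_assoc]
      _ ≤ (phiE K S t).toReal * M :=
          mul_le_mul_of_nonneg_right
            (sum_translate_le_phiE_toReal hβ hJnn K S t hφ Λ u) hM0

/-- if `φ_β(S,t) < 1` for some finite `S ∋ 0`, then with
`C = ∑_{v∈S} e^{⟨t,v⟩}`, for every finite `Λ` and `u ∈ Λ`,
`∑_{v∈Λ} e^{⟨t,v−u⟩} P_Λ(u,v) ≤ C / (1 − φ_β(S,t))`. -/
theorem statement0 {d : ℕ} (β : ℝ) (hβ : 0 < β) (J : Zd d → ℝ)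
    (hJ0 : J 0 = 0) (hJnn : ∀ x, 0 ≤ J x)
    (K : AdmissibleKernel d β J)
    (S : Finset (Zd d)) (hS : (0 : Zd d) ∈ S) (t : Fin d → ℝ)
    (hφ : phiE K S t < 1) :
    ∀ (Λ : Finset (Zd d)), ∀ u ∈ Λ,
      ∑ v ∈ Λ, Real.exp (dotp t (v - u)) * K.P Λ u v
        ≤ (∑ v ∈ S, Real.exp (dotp t v)) / (1 - (phiE K S t).toReal) := by
  intro Λ u hu
  obtain ⟨w, hw, hmax⟩ := Finset.exists_max_image Λ
    (fun u => ∑ v ∈ Λ, Real.exp (dotp t (v - u)) * K.P Λ u v) ⟨u, hu⟩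
  have hφ1 : (phiE K S t).toReal < 1 := by
    simpa using (ENNReal.toReal_lt_toReal hφ.ne_top ENNReal.one_ne_top).2 hφ
  have hstep := sum_exp_mul_le_add hβ.le hJnn K hS t hφ.ne_top Λ
    (Finset.sum_nonneg fun v _ => mul_nonneg (Real.exp_nonneg _) (K.nonneg _ _ _)) hmax hw
  refine (hmax u hu).trans ?_
  rw [le_div_iff₀ (sub_pos.2 hφ1)]
  linarith
end
end

section
/- Let P be an admissible two-point kernel for β and J that is moreover volume monotone. Let t ∈ ℝ^d and let (n_k)_{k≥1} be a strictly increasing sequence of positive integers such that A := sup_{x∈ℤ^d} ∑_{k≥1 with x∈Λ_{n_k}} ∑_{y∉Λ_{n_k}} e^{⟨t, y−x⟩} J(y−x) < ∞. Then for every l ≥ 1, ∑_{k=1}^{l} φ_β(Λ_{n_k}, t) ≤ β A ∑_{x∈Λ_{n_l}} e^{⟨t,x⟩} P_{Λ_{n_l}}(0,x). -/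
open scoped BigOperators ENNReal

noncomputable section

/-- The box `Λ_n = {−n,…,n}^d ⊂ ℤ^d`. -/
def box (d n : ℕ) : Finset (Zd d) := Fintype.piFinset fun _ => Finset.Icc (-(n : ℤ)) (n : ℤ)

/-- A kernel is volume monotone if `P_Λ(u,v) ≤ P_{Λ'}(u,v)` whenever `Λ ⊆ Λ'`. -/
def VolumeMonotone {d : ℕ} {β : ℝ} {J : Zd d → ℝ} (K : AdmissibleKernel d β J) : Prop :=
  ∀ (Λ Λ' : Finset (Zd d)), Λ ⊆ Λ' → ∀ u v, K.P Λ u v ≤ K.P Λ' u v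

theorem box_mono (d : ℕ) : Monotone (box d) := by
  intro m n hmn x hx
  simp only [box, Fintype.mem_piFinset, Finset.mem_Icc] at hx ⊢
  intro i
  have := hx i
  omega

/-- The mass sent by `x ∈ S` out of `S` under the exponentially tilted coupling. -/
def exitWeight {d : ℕ} (J : Zd d → ℝ) (t : Fin d → ℝ) (S : Finset (Zd d)) (x : Zd d) : ℝ≥0∞ :=
  if x ∈ S then
    ∑' y : {y : Zd d // y ∉ S},
      ENNReal.ofReal (Real.exp (dotp t ((y : Zd d) - x)) * J ((y : Zd d) - x))
  else 0

theorem phiE_eq_sum_exitWeight {d : ℕ} {β : ℝ} {J : Zd d → ℝ} (K : AdmissibleKernel d β J)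
    (S : Finset (Zd d)) (t : Fin d → ℝ) :
    phiE K S t = ENNReal.ofReal β * ∑ x ∈ S,
      ENNReal.ofReal (Real.exp (dotp t x) * K.P S 0 x) * exitWeight J t S x := by
  unfold phiE
  congr 1
  refine Finset.sum_congr rfl fun x hx => ?_
  rw [exitWeight, if_pos hx, ← ENNReal.tsum_mul_left]
  refine tsum_congr fun y => ?_
  rw [← ENNReal.ofReal_mul (mul_nonneg (Real.exp_pos _).le (K.nonneg _ _ _))]
  congr 1
  ring

/-- For a volume monotone kernel, `φ_β(S,t)` is bounded using the kernel of a larger volume. -/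
theorem phiE_le_of_subset {d : ℕ} {β : ℝ} {J : Zd d → ℝ} {K : AdmissibleKernel d β J}
    (hmono : VolumeMonotone K) {S Λ : Finset (Zd d)} (hS : S ⊆ Λ) (t : Fin d → ℝ) :
    phiE K S t ≤ ENNReal.ofReal β * ∑ x ∈ Λ,
      ENNReal.ofReal (Real.exp (dotp t x) * K.P Λ 0 x) * exitWeight J t S x := by
  rw [phiE_eq_sum_exitWeight]
  gcongr ENNReal.ofReal β * ?_
  refine (Finset.sum_le_sum fun x _ => ?_).trans (Finset.sum_le_sum_of_subset hS)
  gcongr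
  exact hmono S Λ hS 0 x

/-- for a volume monotone admissible kernel, a strictly increasing sequence
`(n_k)_{k≥1}` of positive integers (here `n k` is the paper's `n_{k+1}`) and
`A = sup_{x∈ℤ^d} ∑_{k≥1, x∈Λ_{n_k}} ∑_{y∉Λ_{n_k}} e^{⟨t,y−x⟩} J(y−x) < ∞`, one has, for
every `l ≥ 1` (here `l+1`), `∑_{k=1}^{l} φ_β(Λ_{n_k},t) ≤ βA ∑_{x∈Λ_{n_l}} e^{⟨t,x⟩} P_{Λ_{n_l}}(0,x)`. -/
theorem statement1 {d : ℕ} (β : ℝ) (hβ : 0 < β) (J : Zd d → ℝ)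
    (hJ0 : J 0 = 0) (hJnn : ∀ x, 0 ≤ J x)
    (K : AdmissibleKernel d β J) (hmono : VolumeMonotone K)
    (t : Fin d → ℝ) (n : ℕ → ℕ) (hn : StrictMono n) (hn1 : ∀ k, 0 < n k)
    (A : ℝ≥0∞)
    (hA : A = ⨆ x : Zd d, ∑' k : ℕ,
      if x ∈ box d (n k) then
        (∑' y : {y : Zd d // y ∉ box d (n k)},
          ENNReal.ofReal (Real.exp (dotp t ((y : Zd d) - x)) * J ((y : Zd d) - x)))
      else 0)
    (hAfin : A ≠ ⊤) :
    ∀ l : ℕ,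
      ∑ k ∈ Finset.range (l + 1), phiE K (box d (n k)) t
        ≤ ENNReal.ofReal β * A *
            ENNReal.ofReal (∑ x ∈ box d (n l),
              Real.exp (dotp t x) * K.P (box d (n l)) 0 x) := by
  intro l
  have hle (x : Zd d) :
      ∑ k ∈ Finset.range (l + 1), exitWeight J t (box d (n k)) x ≤ A := by
    rw [hA]
    exact (ENNReal.sum_le_tsum _).trans
      (le_iSup (fun x => ∑' k : ℕ, exitWeight J t (box d (n k)) x) x)
  calc ∑ k ∈ Finset.range (l + 1), phiE K (box d (n k)) t
      ≤ ∑ k ∈ Finset.range (l + 1), ENNReal.ofReal β * ∑ x ∈ box d (n l),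
          ENNReal.ofReal (Real.exp (dotp t x) * K.P (box d (n l)) 0 x)
            * exitWeight J t (box d (n k)) x := by
        refine Finset.sum_le_sum fun k hk => phiE_le_of_subset hmono (box_mono d ?_) t
        exact hn.monotone (Nat.lt_succ_iff.mp (Finset.mem_range.mp hk))
    _ = ENNReal.ofReal β * ∑ x ∈ box d (n l),
          ENNReal.ofReal (Real.exp (dotp t x) * K.P (box d (n l)) 0 x)
            * ∑ k ∈ Finset.range (l + 1), exitWeight J t (box d (n k)) x := by
        rw [← Finset.mul_sum, Finset.sum_comm]
        simp only [Finset.mul_sum]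
    _ ≤ ENNReal.ofReal β * ∑ x ∈ box d (n l),
          ENNReal.ofReal (Real.exp (dotp t x) * K.P (box d (n l)) 0 x) * A := by
        gcongr with x _
        exact hle x
    _ = ENNReal.ofReal β * A * ENNReal.ofReal (∑ x ∈ box d (n l),
          Real.exp (dotp t x) * K.P (box d (n l)) 0 x) := by
        rw [ENNReal.ofReal_sum_of_nonneg fun x _ =>
          mul_nonneg (Real.exp_pos _).le (K.nonneg _ _ _), ← Finset.sum_mul]
        ring
end
end

section
/- Let P be an admissible two-point kernel for β and J that is moreover volume monotone. Let t ∈ ℝ^d and let (n_k)_{k≥1} be a strictly increasing sequence of positive integers such that A := sup_{x∈ℤ^d} ∑_{k≥1 with x∈Λ_{n_k}} ∑_{y∉Λ_{n_k}} e^{⟨t, y−x⟩} J(y−x) < ∞. Assume in addition that φ_β(Λ_{n_k}, t) ≥ 1 for every k ≥ 1. Then for every l ≥ 1 one has ∑_{x∈Λ_{n_l}} e^{⟨t,x⟩} P_{Λ_{n_l}}(0,x) ≥ l/(β A); in particular, ∑_{x∈ℤ^d} e^{⟨t,x⟩} · (sup over finite Λ containing 0 and x of P_Λ(0,x)) = +∞.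 -/
open scoped BigOperators ENNReal

noncomputable section

theorem zero_mem_box (d n : ℕ) : (0 : Zd d) ∈ box d n := by
  simp [box]

theorem box_subset_box (d : ℕ) {m n : ℕ} (h : m ≤ n) : box d m ⊆ box d n := by
  intro x hx
  simp only [box, Fintype.mem_piFinset, Finset.mem_Icc] at hx ⊢
  intro i
  have := hx i
  omega

/-- The finite-volume functional factors through the tilted outgoing weight of each site. -/
theorem phiE_eq {d : ℕ} {β : ℝ} {J : Zd d → ℝ} (K : AdmissibleKernel d β J)
    (S : Finset (Zd d)) (t : Fin d → ℝ) :
    phiE K S t = ENNReal.ofReal β * ∑ x ∈ S, ENNReal.ofReal (Real.exp (dotp t x) * K.P S 0 x) *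
      ∑' y : {y : Zd d // y ∉ S},
        ENNReal.ofReal (Real.exp (dotp t ((y : Zd d) - x)) * J ((y : Zd d) - x)) := by
  unfold phiE
  congr 1
  refine Finset.sum_congr rfl fun x _ => ?_
  rw [← ENNReal.tsum_mul_left]
  refine tsum_congr fun y => ?_
  rw [← ENNReal.ofReal_mul (mul_nonneg (Real.exp_pos _).le (K.nonneg _ _ _))]
  congr 1
  ring

/-- If `φ_β(Λ_{n_k}, t) ≥ 1` for all `k ≤ l`, then `l + 1` is at most `β A` times the tilted
susceptibility in `Λ_{n_l}`. -/
theorem natCast_succ_le_susceptibility_mul {d : ℕ} {β : ℝ} {J : Zd d → ℝ}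
    (K : AdmissibleKernel d β J) (hmono : VolumeMonotone K)
    (t : Fin d → ℝ) {n : ℕ → ℕ} (hn : Monotone n) {A : ℝ≥0∞}
    (hA : ∀ x : Zd d, ∑' k : ℕ,
      (if x ∈ box d (n k) then
        (∑' y : {y : Zd d // y ∉ box d (n k)},
          ENNReal.ofReal (Real.exp (dotp t ((y : Zd d) - x)) * J ((y : Zd d) - x)))
      else 0) ≤ A)
    (hφ : ∀ k : ℕ, 1 ≤ phiE K (box d (n k)) t) (l : ℕ) :
    ((l + 1 : ℕ) : ℝ≥0∞) ≤
      (∑ x ∈ box d (n l), ENNReal.ofReal (Real.exp (dotp t x) * K.P (box d (n l)) 0 x)) *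
        (ENNReal.ofReal β * A) := by
  set W : ℕ → Zd d → ℝ≥0∞ := fun k x => ∑' y : {y : Zd d // y ∉ box d (n k)},
    ENNReal.ofReal (Real.exp (dotp t ((y : Zd d) - x)) * J ((y : Zd d) - x))
  set G : Zd d → ℝ≥0∞ := fun x =>
    ENNReal.ofReal (Real.exp (dotp t x) * K.P (box d (n l)) 0 x)
  have hstep : ∀ k ∈ Finset.range (l + 1), phiE K (box d (n k)) t ≤
      ENNReal.ofReal β * ∑ x ∈ box d (n l), G x * (if x ∈ box d (n k) then W k x else 0) := by
    intro k hk
    have hsub : box d (n k) ⊆ box d (n l) :=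
      box_subset_box d (hn (Nat.lt_succ_iff.mp (Finset.mem_range.mp hk)))
    rw [phiE_eq]
    gcongr
    calc _ ≤ ∑ x ∈ box d (n k), G x * (if x ∈ box d (n k) then W k x else 0) := by
          refine Finset.sum_le_sum fun x hx => ?_
          rw [if_pos hx]
          exact mul_le_mul_left (ENNReal.ofReal_le_ofReal
            (mul_le_mul_of_nonneg_left (hmono _ _ hsub 0 x) (Real.exp_pos _).le)) _
      _ ≤ _ := Finset.sum_le_sum_of_subset hsub
  calc ((l + 1 : ℕ) : ℝ≥0∞) = ∑ _k ∈ Finset.range (l + 1), (1 : ℝ≥0∞) := by simp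
    _ ≤ ∑ k ∈ Finset.range (l + 1), ENNReal.ofReal β *
          ∑ x ∈ box d (n l), G x * (if x ∈ box d (n k) then W k x else 0) :=
        Finset.sum_le_sum fun k hk => (hφ k).trans (hstep k hk)
    _ = ENNReal.ofReal β * ∑ x ∈ box d (n l), G x *
          ∑ k ∈ Finset.range (l + 1), (if x ∈ box d (n k) then W k x else 0) := by
        rw [← Finset.mul_sum, Finset.sum_comm]
        simp_rw [Finset.mul_sum]
    _ ≤ ENNReal.ofReal β * ∑ x ∈ box d (n l), G x * A := by
        gcongr with x
        exact (ENNReal.sum_le_tsum _).trans (hA x)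
    _ = (∑ x ∈ box d (n l), G x) * (ENNReal.ofReal β * A) := by
        rw [← Finset.sum_mul]
        ring

/-- under the assumptions of STATEMENT 1, if moreover `φ_β(Λ_{n_k},t) ≥ 1`
for every `k`, then `∑_{x∈Λ_{n_l}} e^{⟨t,x⟩} P_{Λ_{n_l}}(0,x) ≥ l/(βA)` for every `l ≥ 1`
(here `l+1`); in particular the tilted susceptibility
`∑_{x∈ℤ^d} e^{⟨t,x⟩} sup_{Λ ∋ 0,x} P_Λ(0,x)` is infinite. -/
theorem statement2 {d : ℕ} (β : ℝ) (hβ : 0 < β) (J : Zd d → ℝ)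
    (hJ0 : J 0 = 0) (hJnn : ∀ x, 0 ≤ J x)
    (K : AdmissibleKernel d β J) (hmono : VolumeMonotone K)
    (t : Fin d → ℝ) (n : ℕ → ℕ) (hn : StrictMono n) (hn1 : ∀ k, 0 < n k)
    (A : ℝ≥0∞)
    (hA : A = ⨆ x : Zd d, ∑' k : ℕ,
      if x ∈ box d (n k) then
        (∑' y : {y : Zd d // y ∉ box d (n k)},
          ENNReal.ofReal (Real.exp (dotp t ((y : Zd d) - x)) * J ((y : Zd d) - x)))
      else 0)
    (hAfin : A ≠ ⊤)
    (hφ : ∀ k : ℕ, 1 ≤ phiE K (box d (n k)) t) :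
    (∀ l : ℕ,
      ((l + 1 : ℕ) : ℝ≥0∞) / (ENNReal.ofReal β * A)
        ≤ ENNReal.ofReal (∑ x ∈ box d (n l),
            Real.exp (dotp t x) * K.P (box d (n l)) 0 x)) ∧
    (∑' x : Zd d, ENNReal.ofReal (Real.exp (dotp t x)) *
        ⨆ (Λ : Finset (Zd d)) (_ : (0 : Zd d) ∈ Λ) (_ : x ∈ Λ),
          ENNReal.ofReal (K.P Λ 0 x)) = ⊤ := by
  have key := natCast_succ_le_susceptibility_mul K hmono t hn.monotone
    (fun x => hA ▸ le_iSup (fun x : Zd d => ∑' k : ℕ,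
      if x ∈ box d (n k) then
        (∑' y : {y : Zd d // y ∉ box d (n k)},
          ENNReal.ofReal (Real.exp (dotp t ((y : Zd d) - x)) * J ((y : Zd d) - x)))
      else 0) x) hφ
  refine ⟨fun l => ?_, ?_⟩
  · rw [ENNReal.ofReal_sum_of_nonneg
      fun x _ => mul_nonneg (Real.exp_pos _).le (K.nonneg _ _ _)]
    exact ENNReal.div_le_of_le_mul (key l)
  · set T := ∑' x : Zd d, ENNReal.ofReal (Real.exp (dotp t x)) *
        ⨆ (Λ : Finset (Zd d)) (_ : (0 : Zd d) ∈ Λ) (_ : x ∈ Λ), ENNReal.ofReal (K.P Λ 0 x)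
    have hle : ∀ l : ℕ, ((l + 1 : ℕ) : ℝ≥0∞) ≤ T * (ENNReal.ofReal β * A) := by
      intro l
      refine (key l).trans ?_
      gcongr
      refine le_trans (Finset.sum_le_sum fun x hx => ?_) (ENNReal.sum_le_tsum (box d (n l)))
      rw [ENNReal.ofReal_mul (Real.exp_pos _).le]
      gcongr
      exact le_iSup_of_le (box d (n l)) (le_iSup_of_le (zero_mem_box d (n l))
        (le_iSup_of_le hx le_rfl))
    by_contra hfin
    obtain ⟨m, hm⟩ := ENNReal.exists_nat_gt
      (ENNReal.mul_ne_top hfin (ENNReal.mul_ne_top ENNReal.ofReal_ne_top hAfin))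
    refine absurd ((hle m).trans_lt hm) (not_lt.mpr ?_)
    exact_mod_cast Nat.le_succ m
end
end

section
/- Let ρ be a norm on ℝ^d, let t ∈ ℝ^d satisfy ⟨t,x⟩ ≤ ρ(x) for all x ∈ ℝ^d, and let J(x) = ψ(x) e^{−ρ(x)} for x ≠ 0 and J(0)=0, where ψ : ℤ^d → ℝ≥0 satisfies ψ(x) ≤ K‖x‖^{−(d+1+ε)} for all x ≠ 0, for some K > 0 and ε > 0. Let P be an admissible two-point kernel for β and J that is moreover volume monotone, and assume φ_β(Λ_n, t) ≥ 1 for every n ≥ 1. Then there exists C > 0 such that for every n ≥ 1, ∑_{x∈Λ_n} e^{⟨t,x⟩} P_{Λ_n}(0,x) ≥ C n. -/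
open scoped BigOperators ENNReal

noncomputable section

/-- Canonical embedding `ℤ^d ↪ ℝ^d`. -/
def toR {d : ℕ} (x : Zd d) : Fin d → ℝ := fun i => (x i : ℝ)

/-- Standard inner product on `ℝ^d`. -/
def dotR {d : ℕ} (t x : Fin d → ℝ) : ℝ := ∑ i, t i * x i

/-- Euclidean norm of a lattice point. -/
def eNorm {d : ℕ} (x : Zd d) : ℝ := Real.sqrt (∑ i, ((x i : ℝ)) ^ 2)

/-- The sup norm of a lattice point, as a natural number. -/
def supNorm {d : ℕ} (x : Zd d) : ℕ := Finset.univ.sup fun i => (x i).natAbs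

lemma supNorm_le_iff {d : ℕ} {x : Zd d} {n : ℕ} : supNorm x ≤ n ↔ ∀ i, (x i).natAbs ≤ n := by
  simp [supNorm]

lemma mem_box_iff {d n : ℕ} {x : Zd d} : x ∈ box d n ↔ supNorm x ≤ n := by
  simp only [box, Fintype.mem_piFinset, Finset.mem_Icc, supNorm_le_iff]
  exact forall_congr' fun i => by omega

lemma box_mono_s3 {d m n : ℕ} (h : m ≤ n) : box d m ⊆ box d n := fun _ hx =>
  mem_box_iff.2 ((mem_box_iff.1 hx).trans h)

lemma supNorm_add_le {d : ℕ} (x y : Zd d) : supNorm (x + y) ≤ supNorm x + supNorm y := by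
  refine supNorm_le_iff.2 fun i => (Int.natAbs_add_le _ _).trans ?_
  exact add_le_add (supNorm_le_iff.1 le_rfl i) (supNorm_le_iff.1 le_rfl i)

lemma norm_toR {d : ℕ} (x : Zd d) : ‖toR x‖ = supNorm x := by
  refine le_antisymm ((pi_norm_le_iff_of_nonneg (by positivity)).2 fun i => ?_) ?_
  · have h : (x i).natAbs ≤ supNorm x := supNorm_le_iff.1 le_rfl i
    rw [toR, Real.norm_eq_abs, ← Int.cast_abs, ← Nat.cast_natAbs]
    exact_mod_cast h
  · have h : supNorm x ≤ ⌊‖toR x‖⌋₊ := supNorm_le_iff.2 fun i => Nat.le_floor (by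
      rw [Nat.cast_natAbs, Int.cast_abs]
      exact norm_le_pi_norm (toR x) i)
    exact (Nat.le_floor_iff (norm_nonneg _)).1 h

lemma supNorm_le_eNorm {d : ℕ} (x : Zd d) : (supNorm x : ℝ) ≤ eNorm x := by
  rw [← norm_toR]
  refine (pi_norm_le_iff_of_nonneg (Real.sqrt_nonneg _)).2 fun i => ?_
  exact Real.abs_le_sqrt (Finset.single_le_sum (f := fun i => ((x i : ℝ)) ^ 2)
    (fun _ _ => sq_nonneg _) (Finset.mem_univ i))

lemma supNorm_pos {d : ℕ} {x : Zd d} (hx : x ≠ 0) : 0 < supNorm x := by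
  contrapose! hx
  exact funext fun i => by simpa using supNorm_le_iff.1 hx i

lemma summable_supNorm_rpow {d : ℕ} {r : ℝ} (hr : r < -d) :
    Summable fun x : Zd d => (supNorm x : ℝ) ^ r := by
  let b := Pi.basisFun ℝ (Fin d)
  let L := Submodule.span ℤ (Set.range b)
  have hL : Module.finrank ℤ L = d := by
    rw [ZLattice.rank ℝ L]; simp
  let e : Zd d → L := fun x => ⟨toR x, by
    have : toR x = ∑ i, x i • b i := by
      ext j
      simp [toR, b, Finset.sum_apply, Pi.single_apply]
    rw [this]
    exact Submodule.sum_mem _ fun i _ =>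
      Submodule.smul_mem _ _ (Submodule.subset_span ⟨i, rfl⟩)⟩
  have he : Function.Injective e := fun x y h => funext fun i => by
    exact Int.cast_injective (α := ℝ) (congrFun (congrArg Subtype.val h) i)
  have := (ZLattice.summable_norm_rpow L r (by rwa [hL])).comp_injective he
  refine this.congr fun x => ?_
  change ‖toR x‖ ^ r = _
  rw [norm_toR]

/-- At most `supNorm z` of the boxes containing `x` do not contain `x + z`. -/
lemma card_separating_boxes_le {d : ℕ} (x z : Zd d) (s : Finset ℕ) :
    (s.filter fun n => x ∈ box d n ∧ x + z ∉ box d n).card ≤ supNorm z := by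
  have hsub : (s.filter fun n => x ∈ box d n ∧ x + z ∉ box d n) ⊆
      Finset.Ico (supNorm x) (supNorm (x + z)) := fun n hn => by
    simpa [mem_box_iff] using (Finset.mem_filter.1 hn).2
  have := Finset.card_le_card hsub
  have := supNorm_add_le x z
  rw [Nat.card_Ico] at *
  omega

/-- Summing `φ_β(Λ_n, t)` over `n ≤ N` costs at most the first moment of the tilted coupling times
the tilted susceptibility of `Λ_N`. -/
lemma sum_phiE_box_le {d : ℕ} {β : ℝ} {J : Zd d → ℝ} (K : AdmissibleKernel d β J)
    (hmono : VolumeMonotone K) (hJ : ∀ z, 0 ≤ J z) (t : Fin d → ℝ) (N : ℕ) :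
    ∑ n ∈ Finset.Icc 1 N, phiE K (box d n) t ≤ ENNReal.ofReal β *
      (∑ x ∈ box d N, ENNReal.ofReal (Real.exp (dotp t x) * K.P (box d N) 0 x)) *
        ∑' z : Zd d, ENNReal.ofReal (supNorm z * (J z * Real.exp (dotp t z))) := by
  classical
  let a : Zd d → ℝ≥0∞ := fun x => ENNReal.ofReal (Real.exp (dotp t x) * K.P (box d N) 0 x)
  let w : Zd d → ℝ≥0∞ := fun z => ENNReal.ofReal (J z * Real.exp (dotp t z))
  let g : ℕ → Zd d → Zd d → ℝ≥0∞ := fun n x z =>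
    if x ∈ box d n ∧ x + z ∉ box d n then w z else 0
  have hterm : ∀ n ∈ Finset.Icc 1 N, phiE K (box d n) t ≤
      ENNReal.ofReal β * ∑ x ∈ box d N, a x * ∑' z, g n x z := by
    intro n hn
    have hnN := box_mono_s3 (d := d) (Finset.mem_Icc.1 hn).2
    unfold phiE
    gcongr
    refine (Finset.sum_le_sum fun x hx => ?_).trans (Finset.sum_le_sum_of_subset hnN)
    have hinj : Function.Injective fun y : {y // y ∉ box d n} => (y : Zd d) - x :=
      sub_left_injective.comp Subtype.val_injective
    rw [← ENNReal.tsum_mul_left]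
    refine (ENNReal.tsum_le_tsum fun y => ?_).trans (ENNReal.tsum_comp_le_tsum_of_injective hinj _)
    have hy : (y : Zd d) ∉ box d n := y.2
    have hg : g n x (y - x) = w (y - x) := by
      simp [g, hx, hy]
    change _ ≤ a x * g n x (y - x)
    rw [hg, ← ENNReal.ofReal_mul (mul_nonneg (Real.exp_nonneg _) (K.nonneg _ _ _)), mul_assoc]
    refine ENNReal.ofReal_le_ofReal (mul_le_mul_of_nonneg_right
      (mul_le_mul_of_nonneg_left (hmono _ _ hnN _ _) (Real.exp_nonneg _))
      (mul_nonneg (hJ _) (Real.exp_nonneg _)))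
  have hcount : ∀ x, ∑ n ∈ Finset.Icc 1 N, ∑' z, g n x z ≤
      ∑' z : Zd d, ENNReal.ofReal (supNorm z * (J z * Real.exp (dotp t z))) := by
    intro x
    rw [← Summable.tsum_finsetSum fun _ _ => ENNReal.summable]
    refine ENNReal.tsum_le_tsum fun z => ?_
    rw [← Finset.sum_filter, Finset.sum_const, nsmul_eq_mul,
      ENNReal.ofReal_mul (Nat.cast_nonneg _), ENNReal.ofReal_natCast]
    gcongr
    exact card_separating_boxes_le x z _
  calc ∑ n ∈ Finset.Icc 1 N, phiE K (box d n) t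
      ≤ ∑ n ∈ Finset.Icc 1 N, ENNReal.ofReal β * ∑ x ∈ box d N, a x * ∑' z, g n x z :=
        Finset.sum_le_sum hterm
    _ = ENNReal.ofReal β * ∑ x ∈ box d N, a x * ∑ n ∈ Finset.Icc 1 N, ∑' z, g n x z := by
        rw [← Finset.mul_sum, Finset.sum_comm]
        simp_rw [Finset.mul_sum]
    _ ≤ _ := by
        rw [mul_assoc, Finset.sum_mul]
        gcongr with x
        exact hcount x

lemma tilted_coupling_le {d : ℕ} {ρ : (Fin d → ℝ) → ℝ} {t : Fin d → ℝ}
    (ht : ∀ x : Fin d → ℝ, dotR t x ≤ ρ x) {ψ J : Zd d → ℝ} (hψnn : ∀ x, 0 ≤ ψ x) {Kc ε : ℝ}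
    (hε : 0 < ε) (hK : 0 < Kc)
    (hψb : ∀ x : Zd d, x ≠ 0 → ψ x ≤ Kc * eNorm x ^ (-((d : ℝ) + 1 + ε))) (hJ0 : J 0 = 0)
    (hJdef : ∀ x : Zd d, x ≠ 0 → J x = ψ x * Real.exp (-ρ (toR x))) (z : Zd d) :
    supNorm z * (J z * Real.exp (dotp t z)) ≤ Kc * (supNorm z : ℝ) ^ (-((d : ℝ) + ε)) := by
  rcases eq_or_ne z 0 with rfl | hz
  · rw [hJ0]
    simp only [zero_mul, mul_zero]
    positivity
  have hpos : (0 : ℝ) < supNorm z := by exact_mod_cast supNorm_pos hz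
  have hJz : J z * Real.exp (dotp t z) ≤ Kc * (supNorm z : ℝ) ^ (-((d : ℝ) + 1 + ε)) := by
    rw [hJdef z hz, mul_assoc, ← Real.exp_add]
    calc ψ z * Real.exp (-ρ (toR z) + dotp t z) ≤ ψ z * 1 :=
          mul_le_mul_of_nonneg_left (Real.exp_le_one_iff.2 (by
            have : dotp t z ≤ ρ (toR z) := ht (toR z)
            linarith)) (hψnn z)
      _ ≤ Kc * eNorm z ^ (-((d : ℝ) + 1 + ε)) := by rw [mul_one]; exact hψb z hz
      _ ≤ _ := mul_le_mul_of_nonneg_left (Real.rpow_le_rpow_of_nonpos hpos (supNorm_le_eNorm z)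
          (by linarith [(Nat.cast_nonneg d : (0 : ℝ) ≤ d)])) hK.le
  calc _ ≤ (supNorm z : ℝ) * (Kc * (supNorm z : ℝ) ^ (-((d : ℝ) + 1 + ε))) := by gcongr
    _ = _ := by
      rw [show -((d : ℝ) + ε) = 1 + -((d : ℝ) + 1 + ε) by ring, Real.rpow_add hpos,
        Real.rpow_one]
      ring

/-- if `ρ` is a norm, `⟨t,·⟩ ≤ ρ`, `J(x) = ψ(x)e^{−ρ(x)}` with
`ψ(x) ≤ K‖x‖^{−(d+1+ε)}`, and the volume monotone admissible kernel satisfies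
`φ_β(Λ_n,t) ≥ 1` for all `n ≥ 1`, then `∑_{x∈Λ_n} e^{⟨t,x⟩} P_{Λ_n}(0,x) ≥ Cn`. -/
theorem statement3 {d : ℕ} (β : ℝ) (hβ : 0 < β)
    (ρ : (Fin d → ℝ) → ℝ)
    (hρ_tri : ∀ x y, ρ (x + y) ≤ ρ x + ρ y)
    (hρ_hom : ∀ (c : ℝ) (x), ρ (c • x) = |c| * ρ x)
    (hρ_def : ∀ x, ρ x = 0 → x = 0)
    (t : Fin d → ℝ) (ht : ∀ x : Fin d → ℝ, dotR t x ≤ ρ x)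
    (ψ : Zd d → ℝ) (hψnn : ∀ x, 0 ≤ ψ x)
    (Kc ε : ℝ) (hK : 0 < Kc) (hε : 0 < ε)
    (hψb : ∀ x : Zd d, x ≠ 0 → ψ x ≤ Kc * eNorm x ^ (-((d : ℝ) + 1 + ε)))
    (J : Zd d → ℝ) (hJ0 : J 0 = 0)
    (hJdef : ∀ x : Zd d, x ≠ 0 → J x = ψ x * Real.exp (-ρ (toR x)))
    (K : AdmissibleKernel d β J) (hmono : VolumeMonotone K)
    (hφ : ∀ m : ℕ, 1 ≤ m → 1 ≤ phiE K (box d m) t) :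
    ∃ C : ℝ, 0 < C ∧ ∀ m : ℕ, 1 ≤ m →
      C * m ≤ ∑ x ∈ box d m, Real.exp (dotp t x) * K.P (box d m) 0 x := by
  have hJ : ∀ z, 0 ≤ J z := fun z => by
    rcases eq_or_ne z 0 with rfl | hz
    · exact hJ0.ge
    · rw [hJdef z hz]
      exact mul_nonneg (hψnn z) (Real.exp_nonneg _)
  let f : Zd d → ℝ := fun z => supNorm z * (J z * Real.exp (dotp t z))
  have hf0 : ∀ z, 0 ≤ f z := fun z =>
    mul_nonneg (Nat.cast_nonneg _) (mul_nonneg (hJ z) (Real.exp_nonneg _))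
  have hf : Summable f := Summable.of_nonneg_of_le hf0
    (tilted_coupling_le ht hψnn hε hK hψb hJ0 hJdef)
    ((summable_supNorm_rpow (by linarith)).mul_left Kc)
  have hM : 0 ≤ ∑' z, f z := tsum_nonneg hf0
  refine ⟨(β * (∑' z, f z) + 1)⁻¹, by positivity, fun N _ => ?_⟩
  set G := ∑ x ∈ box d N, Real.exp (dotp t x) * K.P (box d N) 0 x
  have hterm : ∀ x ∈ box d N, 0 ≤ Real.exp (dotp t x) * K.P (box d N) 0 x := fun x _ =>
    mul_nonneg (Real.exp_nonneg _) (K.nonneg _ _ _)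
  have hG : 0 ≤ G := Finset.sum_nonneg hterm
  have hN : (N : ℝ≥0∞) ≤ ENNReal.ofReal (β * G * ∑' z, f z) := by
    calc (N : ℝ≥0∞) = ∑ n ∈ Finset.Icc 1 N, 1 := by simp
      _ ≤ ∑ n ∈ Finset.Icc 1 N, phiE K (box d n) t :=
        Finset.sum_le_sum fun n hn => hφ n (Finset.mem_Icc.1 hn).1
      _ ≤ _ := sum_phiE_box_le K hmono hJ t N
      _ = _ := by
        rw [← ENNReal.ofReal_sum_of_nonneg hterm, ← ENNReal.ofReal_tsum_of_nonneg hf0 hf,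
          ← ENNReal.ofReal_mul hβ.le, ← ENNReal.ofReal_mul (by positivity)]
  rw [← ENNReal.ofReal_natCast, ENNReal.ofReal_le_ofReal_iff (by positivity)] at hN
  rw [inv_mul_le_iff₀ (by positivity)]
  linarith
end
end

section
/- Let G = (V,E) be a finite graph with coupling constants J : E → ℝ≥0 and β > 0, and let w, ∂ and Z be the associated random-current weight, source map and partition functions. Then for every B ⊆ V and every collection of pairwise distinct edges e_1, …, e_k ∈ E, one has ∑_{n : ∂n = B and n_{e_i} ≥ 1 for all 1 ≤ i ≤ k} w(n) ≤ β^k (∏_{i=1}^k J_{e_i}) · Z(B Δ e_1 Δ ⋯ Δ e_k). -/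
open scoped BigOperators

noncomputable section

variable {V E : Type} [Fintype V] [Fintype E] [DecidableEq V] [DecidableEq E]

/-- The degree `∑_{e ∋ x} n_e` of a vertex `x` in a current `n` on the finite
(multi)graph with edge-endpoint maps `g1, g2`. -/
def curDeg (g1 g2 : E → V) (n : E → ℕ) (x : V) : ℕ :=
  ∑ e : E, if x = g1 e ∨ x = g2 e then n e else 0

/-- The source set `∂n = {x ∈ V : ∑_{e ∋ x} n_e is odd}` of a current `n`. -/
def curSources (g1 g2 : E → V) (n : E → ℕ) : Finset V :=
  Finset.univ.filter fun x => Odd (curDeg g1 g2 n x)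

/-- The random-current weight `w(n) = ∏_{e∈E} (βJ_e)^{n_e}/n_e!`. -/
def curWeight (β : ℝ) (J : E → ℝ) (n : E → ℕ) : ℝ :=
  ∏ e : E, (β * J e) ^ n e / (Nat.factorial (n e) : ℝ)

/-- The random-current partition function `Z(F) = ∑_{n : ∂n = F} w(n)`. -/
def curZ (g1 g2 : E → V) (β : ℝ) (J : E → ℝ) (F : Finset V) : ℝ :=
  ∑' n : E → ℕ, if curSources g1 g2 n = F then curWeight β J n else 0

/-- Adding one unit of current along `e` toggles the endpoints of `e` in the source set. -/
lemma curSources_add_single (g1 g2 : E → V) (n : E → ℕ) (e : E) :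
    curSources g1 g2 (n + Pi.single e 1) = symmDiff (curSources g1 g2 n) {g1 e, g2 e} := by
  ext x
  have hdeg : curDeg g1 g2 (n + Pi.single e 1) x =
      curDeg g1 g2 n x + if x = g1 e ∨ x = g2 e then 1 else 0 := by
    have hsingle : (∑ e' : E, if x = g1 e' ∨ x = g2 e' then (Pi.single e 1 : E → ℕ) e' else 0) =
        if x = g1 e ∨ x = g2 e then 1 else 0 := by
      rw [Finset.sum_eq_single e]
      · simp
      · intro b _ hb
        simp [Pi.single_eq_of_ne hb]
      · simp
    rw [← hsingle, curDeg, curDeg, ← Finset.sum_add_distrib]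
    refine Finset.sum_congr rfl fun e' _ => ?_
    split_ifs <;> simp
  simp only [curSources, Finset.mem_symmDiff, Finset.mem_filter, Finset.mem_univ, true_and,
    Finset.mem_insert, Finset.mem_singleton, hdeg]
  by_cases hx : x = g1 e ∨ x = g2 e
  · simp [hx, Nat.odd_add_one]
  · simp [hx]

lemma curSources_eq_foldl (g1 g2 : E → V) {ι : Type} (es : ι → E)
    (l : List ι) (n : E → ℕ) :
    curSources g1 g2 n = l.foldl (fun F i => symmDiff F {g1 (es i), g2 (es i)})
      (curSources g1 g2 (n + (l.map fun i => Pi.single (es i) 1).sum)) := by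
  induction l with
  | nil => simp
  | cons i l ih =>
    rw [List.map_cons, List.sum_cons, add_comm (Pi.single (es i) 1), ← add_assoc,
      curSources_add_single g1 g2, List.foldl_cons, symmDiff_symmDiff_cancel_right]
    exact ih

lemma curWeight_nonneg {β : ℝ} {J : E → ℝ} (hJ : ∀ e, 0 ≤ β * J e) (n : E → ℕ) :
    0 ≤ curWeight β J n :=
  Finset.prod_nonneg fun e _ => div_nonneg (pow_nonneg (hJ e) _) (Nat.cast_nonneg _)

lemma curWeight_add_single_le {β : ℝ} {J : E → ℝ} (hJ : ∀ e, 0 ≤ β * J e) (n : E → ℕ) (e : E) :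
    curWeight β J (n + Pi.single e 1) ≤ β * J e * curWeight β J n := by
  have hfactor : β * J e = ∏ e' : E, if e' = e then β * J e' else 1 := by simp
  rw [hfactor, curWeight, curWeight, ← Finset.prod_mul_distrib]
  refine Finset.prod_le_prod
    (fun e' _ => div_nonneg (pow_nonneg (hJ e') _) (Nat.cast_nonneg _)) fun e' _ => ?_
  by_cases h : e' = e
  · subst h
    simp only [Pi.add_apply, Pi.single_eq_same, if_true]
    rw [pow_succ', mul_div_assoc]
    refine mul_le_mul_of_nonneg_left ?_ (hJ e')
    exact div_le_div_of_nonneg_left (pow_nonneg (hJ e') _) (by positivity)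
      (by exact_mod_cast Nat.factorial_le (Nat.le_succ _))
  · simp [h]

lemma curWeight_add_sum_le {β : ℝ} {J : E → ℝ} (hJ : ∀ e, 0 ≤ β * J e) {ι : Type} (es : ι → E)
    (l : List ι) (n : E → ℕ) :
    curWeight β J (n + (l.map fun i => Pi.single (es i) 1).sum) ≤
      (l.map fun i => β * J (es i)).prod * curWeight β J n := by
  induction l with
  | nil => simp
  | cons i l ih =>
    rw [List.map_cons, List.sum_cons, add_comm (Pi.single (es i) 1), ← add_assoc, List.map_cons,
      List.prod_cons, mul_assoc]
    exact (curWeight_add_single_le hJ _ _).trans (mul_le_mul_of_nonneg_left ih (hJ _))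

lemma summable_curWeight {β : ℝ} {J : E → ℝ} (hJ : ∀ e, 0 ≤ β * J e) :
    Summable (curWeight β J) := by
  refine summable_of_sum_le (c := ∏ e, Real.exp (β * J e)) (curWeight_nonneg hJ) fun s => ?_
  let N : ℕ := (s.sup fun n => Finset.univ.sup n) + 1
  have hs : s ⊆ Fintype.piFinset fun _ : E => Finset.range N := by
    intro n hn
    rw [Fintype.mem_piFinset]
    intro e
    have h₁ : n e ≤ Finset.univ.sup n := Finset.le_sup (Finset.mem_univ e)
    have h₂ : Finset.univ.sup n ≤ s.sup fun n => Finset.univ.sup n :=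
      Finset.le_sup (f := fun n : E → ℕ => Finset.univ.sup n) hn
    exact Finset.mem_range.2 (Nat.lt_succ_of_le (h₁.trans h₂))
  calc ∑ n ∈ s, curWeight β J n
      ≤ ∑ n ∈ Fintype.piFinset fun _ : E => Finset.range N, curWeight β J n :=
        Finset.sum_le_sum_of_subset_of_nonneg hs fun n _ _ => curWeight_nonneg hJ n
    _ = ∏ e, ∑ j ∈ Finset.range N, (β * J e) ^ j / (Nat.factorial j : ℝ) :=
        (Finset.prod_univ_sum (fun _ : E => Finset.range N)
          fun e j => (β * J e) ^ j / (Nat.factorial j : ℝ)).symm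
    _ ≤ ∏ e, Real.exp (β * J e) :=
        Finset.prod_le_prod
          (fun e _ => Finset.sum_nonneg fun j _ =>
            div_nonneg (pow_nonneg (hJ e) _) (Nat.cast_nonneg _))
          fun e _ => Real.sum_le_exp_of_nonneg (hJ e) N

lemma sum_single_le {ι : Type} [Fintype ι] {es : ι → E} (hinj : Function.Injective es)
    {n : E → ℕ} (hn : ∀ i, 1 ≤ n (es i)) : ∑ i, (Pi.single (es i) 1 : E → ℕ) ≤ n := by
  intro e
  rw [Finset.sum_apply]
  by_cases he : ∃ i, es i = e
  · obtain ⟨i, rfl⟩ := he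
    rw [Finset.sum_eq_single i]
    · simpa using hn i
    · intro j _ hj
      exact Pi.single_eq_of_ne (fun h => hj (hinj h.symm)) _
    · simp
  · rw [Finset.sum_eq_zero]
    · exact Nat.zero_le _
    · intro i _
      exact Pi.single_eq_of_ne (fun h => he ⟨i, h.symm⟩) _

/-- for any `B ⊆ V` and pairwise distinct edges `e_1, …, e_k`,
`∑_{∂n = B, n_{e_i} ≥ 1 ∀i} w(n) ≤ β^k (∏_i J_{e_i}) Z(B Δ e_1 Δ ⋯ Δ e_k)`. -/
theorem statement8 (g1 g2 : E → V) (hloop : ∀ e, g1 e ≠ g2 e)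
    (J : E → ℝ) (hJ : ∀ e, 0 ≤ J e) (β : ℝ) (hβ : 0 < β)
    (B : Finset V) (k : ℕ) (es : Fin k → E) (hinj : Function.Injective es) :
    (∑' n : E → ℕ,
        if curSources g1 g2 n = B ∧ ∀ i, 1 ≤ n (es i) then curWeight β J n else 0)
      ≤ β ^ k * (∏ i, J (es i)) *
          curZ g1 g2 β J
            ((List.finRange k).foldl
              (fun F i => symmDiff F {g1 (es i), g2 (es i)}) B) := by
  have hβJ : ∀ e, 0 ≤ β * J e := fun e => mul_nonneg hβ.le (hJ e)
  set c : E → ℕ := ((List.finRange k).map fun i => Pi.single (es i) 1).sum with hc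
  have hc' : c = ∑ i, Pi.single (es i) 1 := (Fin.sum_univ_def _).symm
  have hprod : β ^ k * ∏ i, J (es i) = ((List.finRange k).map fun i => β * J (es i)).prod := by
    rw [← Fin.prod_univ_def, Finset.prod_mul_distrib]
    simp
  set F := (List.finRange k).foldl (fun F i => symmDiff F {g1 (es i), g2 (es i)}) B with hF
  have hsumm : Summable fun n => if curSources g1 g2 n = F then curWeight β J n else 0 :=
    (summable_curWeight hβJ).of_nonneg_of_le
      (fun n => by split_ifs <;> simp [curWeight_nonneg hβJ])
      (fun n => by split_ifs <;> simp [curWeight_nonneg hβJ])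
  have hsupp : (Function.support fun n : E → ℕ =>
      if curSources g1 g2 n = B ∧ ∀ i, 1 ≤ n (es i) then curWeight β J n else 0) ⊆
      Set.range fun n => n + c := by
    intro n hn
    have h : curSources g1 g2 n = B ∧ ∀ i, 1 ≤ n (es i) := by
      by_contra h
      exact hn (if_neg h)
    exact ⟨n - c, tsub_add_cancel_of_le (hc' ▸ sum_single_le hinj h.2)⟩
  rw [← (add_left_injective c).tsum_eq hsupp, curZ, ← tsum_mul_left, hprod]
  have hle : ∀ n : E → ℕ,
      (if curSources g1 g2 (n + c) = B ∧ ∀ i, 1 ≤ (n + c) (es i)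
        then curWeight β J (n + c) else 0) ≤
      ((List.finRange k).map fun i => β * J (es i)).prod *
        if curSources g1 g2 n = F then curWeight β J n else 0 := by
    intro n
    split_ifs with h₁ h₂ h₂
    · exact curWeight_add_sum_le hβJ es _ n
    · exact absurd (by rw [curSources_eq_foldl g1 g2 es (List.finRange k) n, ← hc, h₁.1]) h₂
    · refine mul_nonneg (List.prod_nonneg fun a ha => ?_) (curWeight_nonneg hβJ n)
      obtain ⟨i, -, rfl⟩ := List.mem_map.1 ha
      exact hβJ _
    · simp
  have hright := hsumm.mul_left ((List.finRange k).map fun i => β * J (es i)).prod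
  refine Summable.tsum_le_tsum hle (hright.of_nonneg_of_le (fun n => ?_) hle) hright
  split_ifs <;> simp [curWeight_nonneg hβJ]
end
end
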